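/- arXiv:1305.3928 — 4 statements merged into one kernel-verified Lean document; each statement's English description precedes it below -/
import Mathlib

section
/- Let p be an m×m row-stochastic matrix, let j ∈ {1,…,m}, and let I(-j) denote the m×m identity matrix with its j-th diagonal entry set to 0, so that p·I(-j) is p with its j-th column replaced by zeros. Then the matrix I − p·I(-j) is nonsingular if and only if state j is universally accessible for p, i.e., for every state i there exists a positive integer n with (p^n)_{ij} > 0. -/
/-- `Imj j` is the identity matrix with its `j`-th diagonal entry set to `0`;
thus `p * Imj j` equals `p` with its `j`-th column replaced by zeros. -/
noncomputable def Imj {m : ℕ} (j : Fin m) : Matrix (Fin m) (Fin m) ℝ :=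
  Matrix.diagonal (fun i => if i = j then 0 else 1)

theorem mul_Imj_mulVec {m : ℕ} (p : Matrix (Fin m) (Fin m) ℝ) (j : Fin m) (v : Fin m → ℝ)
    (i : Fin m) :
    ((p * Imj j).mulVec v) i = ∑ k, p i k * (if k = j then 0 else v k) := by
  rw [← Matrix.mulVec_mulVec, Imj, Matrix.mulVec, dotProduct]
  simp [Matrix.mulVec_diagonal]

/-- From a closed set of states none of which reaches `j` in one step, `j` is never reached. -/
theorem pow_apply_eq_zero_of_closed {m : ℕ} (p : Matrix (Fin m) (Fin m) ℝ) (j : Fin m)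
    (C : Set (Fin m)) (hj : ∀ i ∈ C, p i j = 0) (hC : ∀ i ∈ C, ∀ k, p i k ≠ 0 → k ∈ C)
    (n : ℕ) : ∀ i ∈ C, (p ^ (n + 1)) i j = 0 := by
  induction n with
  | zero => simpa using hj
  | succ n ih =>
    intro i hi
    rw [pow_succ', Matrix.mul_apply]
    refine Finset.sum_eq_zero fun k _ => ?_
    by_cases hk : p i k = 0
    · simp [hk]
    · simp [ih k (hC i hi k hk)]

/-- The coordinates where a fixed vector of `p * Imj j` attains its maximal absolute value
form a closed set that does not reach `j` in one step. -/
theorem eq_zero_or_abs_eq_of_fixed {m : ℕ} (p : Matrix (Fin m) (Fin m) ℝ)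
    (hnn : ∀ i k, 0 ≤ p i k) (hrow : ∀ i, ∑ k, p i k = 1) (j : Fin m) (v : Fin m → ℝ)
    (hv : (p * Imj j).mulVec v = v) (M : ℝ) (hM : 0 < M) (hle : ∀ k, |v k| ≤ M)
    (i : Fin m) (hi : |v i| = M) (k : Fin m) (hk : p i k ≠ 0) : k ≠ j ∧ |v k| = M := by
  have hterm : ∀ k ∈ Finset.univ, 0 ≤ p i k * (M - if k = j then 0 else |v k|) := by
    intro k _
    refine mul_nonneg (hnn i k) ?_
    split_ifs
    · linarith
    · linarith [hle k]
  have hbound : M ≤ ∑ k, p i k * (if k = j then 0 else |v k|) := by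
    have h := congrFun hv i
    rw [mul_Imj_mulVec] at h
    rw [← hi, ← h]
    refine (Finset.abs_sum_le_sum_abs _ _).trans (Finset.sum_le_sum fun k _ => ?_)
    rw [abs_mul, abs_of_nonneg (hnn i k)]
    split_ifs <;> simp
  have hsum : ∑ k, p i k * (M - if k = j then 0 else |v k|) = 0 := by
    refine le_antisymm ?_ (Finset.sum_nonneg hterm)
    simp only [mul_sub, Finset.sum_sub_distrib, ← Finset.sum_mul, hrow]
    linarith
  have h0 := (mul_eq_zero.mp ((Finset.sum_eq_zero_iff_of_nonneg hterm).mp hsum k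
    (Finset.mem_univ k))).resolve_left hk
  split_ifs at h0 with hkj
  · linarith
  · exact ⟨hkj, by linarith⟩

theorem isUnit_one_sub_mul_Imj {m : ℕ} (p : Matrix (Fin m) (Fin m) ℝ)
    (hnn : ∀ i k, 0 ≤ p i k) (hrow : ∀ i, ∑ k, p i k = 1) (j : Fin m)
    (hacc : ∀ i : Fin m, ∃ n : ℕ, 0 < n ∧ 0 < (p ^ n) i j) :
    IsUnit (1 - p * Imj j) := by
  rw [← Matrix.mulVec_injective_iff_isUnit, ← Matrix.coe_mulVecLin,
    ← LinearMap.ker_eq_bot, LinearMap.ker_eq_bot']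
  intro v hv
  rw [Matrix.mulVecLin_apply, Matrix.sub_mulVec, Matrix.one_mulVec, sub_eq_zero] at hv
  by_contra hne
  obtain ⟨l, hl⟩ := Function.ne_iff.mp hne
  obtain ⟨i, -, hi⟩ := Finset.exists_max_image Finset.univ (fun k => |v k|) ⟨j, Finset.mem_univ j⟩
  have hstep := eq_zero_or_abs_eq_of_fixed p hnn hrow j v hv.symm |v i|
    ((abs_pos.mpr hl).trans_le (hi l (Finset.mem_univ l))) (fun k => hi k (Finset.mem_univ k))
  obtain ⟨n, hn, hpos⟩ := hacc i
  obtain ⟨n, rfl⟩ := Nat.exists_eq_add_one.mpr hn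
  exact hpos.ne' (pow_apply_eq_zero_of_closed p j {k | |v k| = |v i|}
    (fun a ha => by_contra fun h => (hstep a ha j h).1 rfl)
    (fun a ha k h => (hstep a ha k h).2) n i rfl)

theorem not_isUnit_of_closed {m : ℕ} (p : Matrix (Fin m) (Fin m) ℝ)
    (hrow : ∀ i, ∑ k, p i k = 1) (j : Fin m) (C : Set (Fin m)) (hne : C.Nonempty)
    (hj : ∀ i ∈ C, p i j = 0) (hC : ∀ i ∈ C, ∀ k, p i k ≠ 0 → k ∈ C) :
    ¬ IsUnit (1 - p * Imj j) := by
  classical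
  intro hu
  have hinj := Matrix.mulVec_injective_iff_isUnit.mpr hu
  let W : Submodule ℝ (Fin m → ℝ) :=
    { carrier := {v | ∀ i ∈ C, v i = 0}
      add_mem' := fun {a b} ha hb i hi => by simp [ha i hi, hb i hi]
      zero_mem' := fun i _ => rfl
      smul_mem' := fun c a ha i hi => by simp [ha i hi] }
  have hW : ∀ v ∈ W, (1 - p * Imj j).mulVecLin v ∈ W := by
    intro v hv i hi
    rw [Matrix.mulVecLin_apply, Matrix.sub_mulVec, Matrix.one_mulVec, Pi.sub_apply,
      mul_Imj_mulVec, hv i hi, zero_sub, neg_eq_zero]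
    refine Finset.sum_eq_zero fun k _ => ?_
    by_cases hk : p i k = 0
    · simp [hk]
    · simp [hv k (hC i hi k hk)]
  have hsurj : Function.Surjective ((1 - p * Imj j).mulVecLin.restrict hW) :=
    LinearMap.injective_iff_surjective.mp fun a b hab =>
      Subtype.ext (hinj (congrArg Subtype.val hab))
  let u : Fin m → ℝ := C.indicator 1
  have hu_mem : (1 - p * Imj j).mulVecLin u ∈ W := by
    intro i hi
    rw [Matrix.mulVecLin_apply, Matrix.sub_mulVec, Matrix.one_mulVec, Pi.sub_apply,
      mul_Imj_mulVec, sub_eq_zero, show u i = 1 by simp [u, hi], ← hrow i]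
    refine Finset.sum_congr rfl fun k _ => ?_
    by_cases hk : p i k = 0
    · simp [hk]
    · have hkj : k ≠ j := fun h => hk (h ▸ hj i hi)
      simp [u, hkj, hC i hi k hk]
  obtain ⟨w, hw⟩ := hsurj ⟨_, hu_mem⟩
  have hwu : (w : Fin m → ℝ) = u := hinj (congrArg Subtype.val hw)
  obtain ⟨c, hc⟩ := hne
  have h0 : u c = 0 := hwu ▸ w.2 c hc
  simp [u, hc] at h0

/-- For a row-stochastic matrix `p`, the matrix `I - p·I(-j)` is nonsingular
if and only if the state `j` is universally accessible for `p`. -/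
theorem stmt_5 {m : ℕ} (p : Matrix (Fin m) (Fin m) ℝ)
    (hnn : ∀ i k, 0 ≤ p i k) (hrow : ∀ i, ∑ k, p i k = 1) (j : Fin m) :
    IsUnit (1 - p * Imj j) ↔
      (∀ i : Fin m, ∃ n : ℕ, 0 < n ∧ 0 < (p ^ n) i j) := by
  refine ⟨fun hu => ?_, isUnit_one_sub_mul_Imj p hnn hrow j⟩
  by_contra! hacc
  refine not_isUnit_of_closed p hrow j {i | ∀ n : ℕ, 0 < n → (p ^ n) i j ≤ 0} hacc
    (fun i hi => le_antisymm (by simpa using hi 1 one_pos) (hnn i j))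
    (fun i hi k hk n hn => ?_) hu
  have hpow : ∀ a, 0 ≤ (p ^ n) a j := fun a =>
    (pow_mem (show p ∈ Matrix.rowStochastic ℝ (Fin m) from
      Matrix.mem_rowStochastic_iff_sum.mpr ⟨hnn, hrow⟩) n).1 a j
  have h := hi (n + 1) n.succ_pos
  rw [pow_succ', Matrix.mul_apply] at h
  have hle := (Finset.single_le_sum (fun a _ => mul_nonneg (hnn i a) (hpow a))
    (Finset.mem_univ k)).trans h
  exact nonpos_of_mul_nonpos_right hle ((hnn i k).lt_of_ne' hk)
end

section
/- Let p be an m×m row-stochastic matrix and let j ∈ {1,…,m}. If the matrix I − p·I(-j) is nonsingular (where p·I(-j) is p with its j-th column zeroed), then state j is universally accessible for p: for every state i there exists a positive integer n with (p^n)_{ij} > 0. -/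
/-- If `k` can be reached in one step from a state that never reaches `j`, then `k` never
reaches `j` either. -/
theorem pow_apply_nonpos_of_pos_apply {ι : Type*} [Fintype ι] [DecidableEq ι] {p : Matrix ι ι ℝ}
    (hnn : ∀ i k, 0 ≤ p i k) {i j k : ι} (hi : ∀ n : ℕ, 0 < n → (p ^ n) i j ≤ 0)
    (hik : 0 < p i k) : ∀ n : ℕ, 0 < n → (p ^ n) k j ≤ 0 := by
  intro n _
  have hpow : ∀ l, 0 ≤ (p ^ n) l j := fun l => Matrix.pow_apply_nonneg hnn n l j
  by_contra! hkj
  have hle : p i k * (p ^ n) k j ≤ (p ^ (n + 1)) i j := by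
    rw [pow_succ', Matrix.mul_apply]
    exact Finset.single_le_sum (f := fun l => p i l * (p ^ n) l j)
      (fun l _ => mul_nonneg (hnn i l) (hpow l)) (Finset.mem_univ k)
  linarith [hi (n + 1) n.succ_pos, mul_pos hik hkj]

/-- For a row-stochastic matrix `p`, if `I - p·I(-j)` is nonsingular, then the
state `j` is universally accessible for `p`: from every state `i` there is a
positive integer `n` with `(p^n)_{ij} > 0`. -/
theorem stmt_7 {m : ℕ} (p : Matrix (Fin m) (Fin m) ℝ)
    (hnn : ∀ i k, 0 ≤ p i k) (hrow : ∀ i, ∑ k, p i k = 1) (j : Fin m)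
    (hunit : IsUnit (1 - p * Imj j)) :
    ∀ i : Fin m, ∃ n : ℕ, 0 < n ∧ 0 < (p ^ n) i j := by
  intro i₀
  by_contra! h₀
  classical
  -- The solution `u` of `u = 1 + p * Imj j * u` has no minimum on the states not reaching `j`.
  obtain ⟨u, hu⟩ := Matrix.mulVec_surjective_iff_isUnit.mpr hunit 1
  let S := Finset.univ.filter fun i => ∀ n : ℕ, 0 < n → (p ^ n) i j ≤ 0
  obtain ⟨i, hiS, hmin⟩ := S.exists_min_image u ⟨i₀, by simpa [S] using h₀⟩
  have hi : ∀ n : ℕ, 0 < n → (p ^ n) i j ≤ 0 := by simpa [S] using hiS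
  have hij : p i j ≤ 0 := by simpa using hi 1 one_pos
  have hui : u i - ∑ k, (p * Imj j) i k * u k = 1 := by
    rw [Matrix.sub_mulVec, Matrix.one_mulVec] at hu
    exact congrFun hu i
  have hge : ∑ k, p i k * u i ≤ ∑ k, (p * Imj j) i k * u k := by
    refine Finset.sum_le_sum fun k _ => ?_
    rw [Imj, Matrix.mul_diagonal]
    rcases (hnn i k).eq_or_lt with hk | hk
    · simp [← hk]
    · have hkj : k ≠ j := by
        rintro rfl
        exact hk.not_ge hij
      have hkS : k ∈ S := by simpa [S] using pow_apply_nonpos_of_pos_apply hnn hi hk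
      simpa [hkj] using mul_le_mul_of_nonneg_left (hmin k hkS) hk.le
  rw [← Finset.sum_mul, hrow, one_mul] at hge
  linarith
end

section
/- Let p be an m×m row-stochastic matrix, let j ∈ {1,…,m} be universally accessible for p, let r ≥ 2, let e^{(1)},…,e^{(r)} be m×m real matrices with e^{(0)} defined as the all-ones matrix J, and let vectors μ^{(1)},…,μ^{(r−1)} ∈ ℝ^m be given. Then the linear system x = p·I(-j)·x + (p ∘ e^{(r)})·1 + Σ_{s=1}^{r−1} C(r,s) · (p ∘ e^{(r−s)}) · (I(-j)·μ^{(s)}) has a unique solution x ∈ ℝ^m, given by x = [I − p·I(-j)]^{-1} [ (p ∘ e^{(r)})·1 + Σ_{s=1}^{r−1} C(r,s) · (p ∘ e^{(r−s)}) · (I(-j)·μ^{(s)}) ], where C(r,s) is the binomial coefficient. -/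
open Matrix

/-- A set of indices closed under the nonzero entries of a matrix is closed under the nonzero
entries of its powers. -/
lemma Matrix.mem_of_pow_apply_ne_zero {ι R : Type*} [Fintype ι] [DecidableEq ι] [Semiring R]
    {p : Matrix ι ι R} {S : Set ι} (hS : ∀ i ∈ S, ∀ k, p i k ≠ 0 → k ∈ S) (n : ℕ) {i k : ι}
    (hi : i ∈ S) (h : (p ^ n) i k ≠ 0) : k ∈ S := by
  induction n generalizing k with
  | zero =>
    rw [pow_zero, Matrix.one_apply] at h
    grind
  | succ n ih =>
    rw [pow_succ, Matrix.mul_apply] at h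
    obtain ⟨l, -, hl⟩ := Finset.exists_ne_zero_of_sum_ne_zero h
    exact hS l (ih (left_ne_zero_of_mul hl)) k (right_ne_zero_of_mul hl)

lemma Imj_mulVec_apply {m : ℕ} (j : Fin m) (v : Fin m → ℝ) (k : Fin m) :
    (Imj j *ᵥ v) k = if k = j then 0 else v k := by
  simp [Imj, Matrix.mulVec_diagonal]

/-- Maximum principle: a fixed vector of `p * Imj j` vanishes when `j` is universally
accessible for the stochastic matrix `p`. -/
lemma eq_zero_of_mul_Imj_mulVec_eq {m : ℕ} {p : Matrix (Fin m) (Fin m) ℝ}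
    (hnn : ∀ i k, 0 ≤ p i k) (hrow : ∀ i, ∑ k, p i k = 1) {j : Fin m}
    (hUA : ∀ i : Fin m, ∃ n : ℕ, 0 < n ∧ 0 < (p ^ n) i j)
    {v : Fin m → ℝ} (hv : (p * Imj j) *ᵥ v = v) : v = 0 := by
  have : Nonempty (Fin m) := ⟨j⟩
  obtain ⟨a, ha⟩ := Finite.exists_max fun i => |v i|
  by_contra hne
  obtain ⟨b, hb⟩ := Function.ne_iff.mp hne
  have hpos : 0 < |v a| := (abs_pos.mpr hb).trans_le (ha b)
  have hle : ∀ k, |(Imj j *ᵥ v) k| ≤ |v a| := fun k => by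
    rw [Imj_mulVec_apply]
    split_ifs
    · simp
    · exact ha k
  have hstep : ∀ i, |v i| = |v a| → ∀ k, p i k ≠ 0 → |v k| = |v a| ∧ k ≠ j := by
    intro i hi k hk
    have hterm : ∀ l ∈ Finset.univ, 0 ≤ p i l * (|v a| - |(Imj j *ᵥ v) l|) :=
      fun l _ => mul_nonneg (hnn i l) (sub_nonneg.mpr (hle l))
    have habs : |v a| ≤ ∑ l, p i l * |(Imj j *ᵥ v) l| := by
      calc |v a| = |∑ l, p i l * (Imj j *ᵥ v) l| := by
            have hvi := congrFun hv i
            rw [← Matrix.mulVec_mulVec] at hvi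
            exact hi.symm.trans (congrArg abs hvi.symm)
        _ ≤ ∑ l, |p i l * (Imj j *ᵥ v) l| := Finset.abs_sum_le_sum_abs _ _
        _ = ∑ l, p i l * |(Imj j *ᵥ v) l| := by simp only [abs_mul, abs_of_nonneg (hnn _ _)]
    have hsum : ∑ l, p i l * (|v a| - |(Imj j *ᵥ v) l|) = 0 := by
      refine le_antisymm ?_ (Finset.sum_nonneg hterm)
      simp only [mul_sub, Finset.sum_sub_distrib, ← Finset.sum_mul, hrow, one_mul]
      linarith
    have hz := (mul_eq_zero.mp
      ((Finset.sum_eq_zero_iff_of_nonneg hterm).mp hsum k (Finset.mem_univ k))).resolve_left hk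
    rw [Imj_mulVec_apply] at hz
    split_ifs at hz with hkj
    · rw [abs_zero, sub_zero] at hz
      exact absurd hz hpos.ne'
    · exact ⟨(sub_eq_zero.mp hz).symm, hkj⟩
  obtain ⟨n, hn, hpn⟩ := hUA a
  obtain ⟨n, rfl⟩ := Nat.exists_eq_succ_of_ne_zero hn.ne'
  rw [Nat.succ_eq_add_one, pow_succ, Matrix.mul_apply] at hpn
  obtain ⟨l, -, hl⟩ := Finset.exists_ne_zero_of_sum_ne_zero hpn.ne'
  have hmem : l ∈ {i | |v i| = |v a|} :=
    Matrix.mem_of_pow_apply_ne_zero (fun i hi k hk => (hstep i hi k hk).1) n rfl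
      (left_ne_zero_of_mul hl)
  exact (hstep l hmem j (right_ne_zero_of_mul hl)).2 rfl

lemma isUnit_det_one_sub_mul_Imj {m : ℕ} {p : Matrix (Fin m) (Fin m) ℝ}
    (hnn : ∀ i k, 0 ≤ p i k) (hrow : ∀ i, ∑ k, p i k = 1) {j : Fin m}
    (hUA : ∀ i : Fin m, ∃ n : ℕ, 0 < n ∧ 0 < (p ^ n) i j) :
    IsUnit (1 - p * Imj j).det := by
  rw [isUnit_iff_ne_zero]
  intro hdet
  obtain ⟨v, hv, hv0⟩ := Matrix.exists_mulVec_eq_zero_iff.mpr hdet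
  rw [Matrix.sub_mulVec, Matrix.one_mulVec, sub_eq_zero] at hv0
  exact hv (eq_zero_of_mul_Imj_mulVec_eq hnn hrow hUA hv0.symm)

/-- Let `p` be row-stochastic with `j` universally accessible, `r ≥ 2`,
`e⁽¹⁾, …, e⁽ʳ⁾` real matrices with `e⁽⁰⁾ = J` the all-ones matrix, and
`μ⁽¹⁾, …, μ⁽ʳ⁻¹⁾` given vectors.  Then the linear system
`x = p·I(-j)·x + (p ∘ e⁽ʳ⁾)·1 + ∑_{s=1}^{r-1} C(r,s) (p ∘ e⁽ʳ⁻ˢ⁾)(I(-j)·μ⁽ˢ⁾)`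
has the unique solution
`x = (I - p·I(-j))⁻¹ [(p ∘ e⁽ʳ⁾)·1 + ∑_{s=1}^{r-1} C(r,s) (p ∘ e⁽ʳ⁻ˢ⁾)(I(-j)·μ⁽ˢ⁾)]`. -/
theorem stmt_12 {m : ℕ} (p : Matrix (Fin m) (Fin m) ℝ)
    (hnn : ∀ i k, 0 ≤ p i k) (hrow : ∀ i, ∑ k, p i k = 1) (j : Fin m)
    (hUA : ∀ i : Fin m, ∃ n : ℕ, 0 < n ∧ 0 < (p ^ n) i j)
    (r : ℕ) (hr : 2 ≤ r) (e : ℕ → Matrix (Fin m) (Fin m) ℝ)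
    (he0 : ∀ i k, e 0 i k = 1) (μ : ℕ → Fin m → ℝ) :
    ∀ x : Fin m → ℝ,
      (x = (p * Imj j) *ᵥ x + (Matrix.hadamard p (e r)) *ᵥ (fun _ => 1)
            + ∑ s ∈ Finset.Ico 1 r, (r.choose s : ℝ) •
                ((Matrix.hadamard p (e (r - s))) *ᵥ (Imj j *ᵥ μ s))) ↔
        x = (1 - p * Imj j)⁻¹ *ᵥ
              ((Matrix.hadamard p (e r)) *ᵥ (fun _ => 1)
                + ∑ s ∈ Finset.Ico 1 r, (r.choose s : ℝ) •
                    ((Matrix.hadamard p (e (r - s))) *ᵥ (Imj j *ᵥ μ s))) := by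
  have hdet := isUnit_det_one_sub_mul_Imj hnn hrow hUA
  intro x
  rw [add_assoc, ← sub_eq_iff_eq_add']
  generalize (Matrix.hadamard p (e r)) *ᵥ (fun _ => 1) + _ = b
  have hx : x - (p * Imj j) *ᵥ x = (1 - p * Imj j) *ᵥ x := by
    rw [Matrix.sub_mulVec, Matrix.one_mulVec]
  rw [hx]
  constructor
  · rintro rfl
    rw [Matrix.mulVec_mulVec, Matrix.nonsing_inv_mul _ hdet, Matrix.one_mulVec]
  · rintro rfl
    rw [Matrix.mulVec_mulVec, Matrix.mul_nonsing_inv _ hdet, Matrix.one_mulVec]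
end

section
/- Let A be a nonnegative m×m real matrix (m ≥ 2) that is reducible (not irreducible). Then there exists a permutation matrix P such that P·A·P^{-1} is block upper triangular with square diagonal blocks A_{11},…,A_{MM} (M ≥ 2), where each diagonal block A_{νν} is either the 1×1 zero matrix or an irreducible matrix. -/
open Relation

/-- A relation on a finite type admits a ranking of its strongly connected components by an
initial segment of the naturals, compatible with reachability. -/
theorem exists_component_ranking {α : Type*} [Finite α] (r : α → α → Prop) :
    ∃ (M : ℕ) (c : α → Fin M), Function.Surjective c ∧
      (∀ i j, ReflTransGen r i j → c i ≤ c j) ∧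
      (∀ i j, c i = c j → ReflTransGen r i j) := by
  classical
  let P : Preorder α :=
    { le := ReflTransGen r
      le_refl := fun _ => ReflTransGen.refl
      le_trans := fun _ _ _ => ReflTransGen.trans }
  let Q := Antisymmetrization α (· ≤ ·)
  have : Finite (LinearExtension Q) := inferInstanceAs (Finite (Quotient _))
  let _ := Fintype.ofFinite (LinearExtension Q)
  let e := (Fintype.orderIsoFinOfCardEq (LinearExtension Q) rfl).symm
  refine ⟨_, fun i => e (toLinearExtension (toAntisymmetrization (· ≤ ·) i)), ?_, ?_, ?_⟩
  · intro x
    obtain ⟨q, rfl⟩ := e.surjective x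
    obtain ⟨i, hi⟩ := Quotient.exists_rep (show Q from q)
    exact ⟨i, congrArg e hi⟩
  · intro i j hij
    exact e.monotone (toLinearExtension.monotone (toAntisymmetrization_mono hij))
  · intro i j hij
    have h : toAntisymmetrization (α := α) (· ≤ ·) i = toAntisymmetrization (· ≤ ·) j :=
      e.injective hij
    exact (Quotient.exact h).1

/-- Reachability through positive entries of a nonnegative matrix gives a positive entry in some
positive power. -/
theorem Matrix.exists_pow_pos_of_transGen {n : Type*} [Fintype n] [DecidableEq n]
    {B : Matrix n n ℝ} (hB : ∀ i j, 0 ≤ B i j) {i j : n}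
    (h : TransGen (fun i j => 0 < B i j) i j) : ∃ η : ℕ, 0 < η ∧ 0 < (B ^ η) i j := by
  induction h with
  | single h => exact ⟨1, one_pos, by simpa using h⟩
  | tail _ hjk ih =>
    obtain ⟨η, -, hη⟩ := ih
    refine ⟨η + 1, η.succ_pos, ?_⟩
    rw [pow_succ, Matrix.mul_apply]
    exact Finset.sum_pos' (fun x _ => mul_nonneg (Matrix.pow_apply_nonneg hB η _ x) (hB x _))
      ⟨_, Finset.mem_univ _, mul_pos hη hjk⟩

/-- A path between two points on the same level of a map monotone along the relation stays on
that level. -/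
theorem Relation.TransGen.subtype_of_monotone {α β : Type*} [PartialOrder β]
    {r : α → α → Prop} {c : α → β} (hc : ∀ i j, r i j → c i ≤ c j) {ν : β} {x y : α}
    (h : TransGen r x y) (hx : c x = ν) (hy : c y = ν) :
    TransGen (fun i j : {i // c i = ν} => r i j) ⟨x, hx⟩ ⟨y, hy⟩ := by
  induction h using TransGen.head_induction_on with
  | single h => exact .single h
  | @head x z hxz hzy ih =>
    have hz : c z = ν := by
      have hle : c z ≤ c y := by
        simpa only [transGen_eq_self] using hzy.lift (p := (· ≤ ·)) c hc
      exact le_antisymm (hy ▸ hle) (hx ▸ hc _ _ hxz)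
    exact .head (b := ⟨z, hz⟩) hxz (ih hz)

theorem Relation.ReflTransGen.transGen_of_ne {α : Type*} {r : α → α → Prop} {i j : α}
    (h : ReflTransGen r i j) (hij : i ≠ j) : TransGen r i j :=
  (reflTransGen_iff_eq_or_transGen.1 h).resolve_left hij.symm

/-- Canonical form of a reducible nonnegative matrix: if a nonnegative `m × m`
matrix `A` (with `m ≥ 2`) is reducible, then after a simultaneous permutation
`σ` of rows and columns (i.e. replacing `A` by `P A P⁻¹` for a permutation
matrix `P`), the matrix is block upper triangular with `M ≥ 2` diagonal blocks
(the block of an index `i` being `b i`, with `b` monotone and surjective), and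
every diagonal block is either a `1 × 1` zero block or an irreducible matrix. -/
theorem stmt_13 {m : ℕ} (hm : 2 ≤ m) (A : Matrix (Fin m) (Fin m) ℝ)
    (hA : ∀ i j, 0 ≤ A i j)
    (hred : ¬ ∀ i j : Fin m, ∃ η : ℕ, 0 < η ∧ 0 < (A ^ η) i j) :
    ∃ (M : ℕ) (_ : 2 ≤ M) (σ : Equiv.Perm (Fin m)) (b : Fin m → Fin M),
      Monotone b ∧ Function.Surjective b ∧
      (A.submatrix σ σ).BlockTriangular b ∧
      ∀ ν : Fin M,
        ((∀ i₁ i₂ : {i // b i = ν}, i₁ = i₂) ∧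
            ∀ i : {i // b i = ν}, A.submatrix σ σ i.1 i.1 = 0) ∨
          (∀ i k : {i // b i = ν}, ∃ η : ℕ, 0 < η ∧
            0 < (((A.submatrix σ σ).submatrix
                (Subtype.val : {i // b i = ν} → Fin m) Subtype.val) ^ η) i k) := by
  obtain ⟨M, c, hsurj, hmono, hreach⟩ := exists_component_ranking fun i j => 0 < A i j
  have hstep : ∀ i j, 0 < A i j → c i ≤ c j := fun i j h => hmono i j (.single h)
  refine ⟨M, ?_, Tuple.sort c, c ∘ Tuple.sort c, Tuple.monotone_sort c,
    hsurj.comp (Tuple.sort c).surjective, ?_, ?_⟩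
  · by_contra hM
    have : Subsingleton (Fin M) := Fin.subsingleton_iff_le_one.2 (by omega)
    have : Nontrivial (Fin m) := Fin.nontrivial_iff_two_le.2 hm
    have hne : ∀ i j, i ≠ j → TransGen (fun i j => 0 < A i j) i j := fun i j hij =>
      (hreach i j (Subsingleton.elim _ _)).transGen_of_ne hij
    refine hred fun i j => Matrix.exists_pow_pos_of_transGen hA ?_
    obtain rfl | hij := eq_or_ne i j
    · obtain ⟨k, hk⟩ := exists_ne i
      exact (hne i k hk.symm).trans (hne k i hk)
    · exact hne i j hij
  · intro i j hij
    by_contra h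
    exact (hstep _ _ ((hA _ _).lt_of_ne' h)).not_gt hij
  · intro ν
    set σ := Tuple.sort c
    by_cases hall : ∀ i k : {i // (c ∘ σ) i = ν}, TransGen (fun i j => 0 < A i j) (σ i) (σ k)
    · right
      intro i k
      refine Matrix.exists_pow_pos_of_transGen (fun _ _ => hA _ _) ?_
      refine Relation.TransGen.subtype_of_monotone (c := c ∘ σ)
        (r := fun i j => 0 < A (σ i) (σ j)) (fun _ _ h => hstep _ _ h) ?_ i.2 k.2
      have h := (hall i k).lift (p := fun i j => 0 < A (σ i) (σ j)) σ.symm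
        (fun _ _ h => by simpa [Function.onFun] using h)
      simpa [Function.onFun] using h
    · left
      push Not at hall
      obtain ⟨i, k, hik⟩ := hall
      have hr : ∀ x y : {i // (c ∘ σ) i = ν},
          ReflTransGen (fun i j => 0 < A i j) (σ x) (σ y) := fun x y =>
        hreach _ _ (x.2.trans y.2.symm)
      have hi : ∀ x, x = i := by
        intro x
        by_contra hx
        have hne : σ x ≠ σ i := fun h => hx (Subtype.ext (σ.injective h))
        exact hik ((((hr i x).transGen_of_ne hne.symm).trans_left (hr x i)).trans_left (hr i k))
      refine ⟨fun x y => (hi x).trans (hi y).symm, fun x => ?_⟩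
      by_contra h
      rw [hi k] at hik
      rw [hi x] at h
      exact hik (.single ((hA _ _).lt_of_ne' h))
end
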